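/- In the setting of batch merging (merging function p : [n] → [ñ] with batches B_1,…,B_ñ, merged points x_{j̃} = centroid of B_j̃ and weights ω_{j̃} = total weight of B_j̃), let C̄ ∈ C_K(k,X̄,Ω) be a clustering such that every batch is wholly assigned to a single cluster, i.e., for each j̃ ∈ [ñ] there is i(j̃) ∈ [k] with ξ̄_{i(j̃),j} = 1 for every j ∈ p^{-1}(j̃). Let C_B = p(C̄) and let S be any k-tuple of sites. Then cost_{A,K}(X_B, C_B, S) + λ^-(A)·Σ_{j̃=1}^{ñ} V_E(B_j̃) ≤ cost_{A,K}(X̄, C̄, S). -/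

import Mathlib

open Finset Matrix

noncomputable section

/-- Squared anisotropic (ellipsoidal) norm `‖v‖_A² = vᵀ A v`. -/
def anormSq {d : ℕ} (A : Matrix (Fin d) (Fin d) ℝ) (v : Fin d → ℝ) : ℝ :=
  v ⬝ᵥ A.mulVec v

/-- `ξ` is a (fractional) `k`-clustering of `n` points. -/
def IsClustering {k n : ℕ} (ξ : Fin k → Fin n → ℝ) : Prop :=
  (∀ i j, 0 ≤ ξ i j) ∧ ∀ j, ∑ i, ξ i j = 1

/-- The weight `ω(C_i)` of the `i`-th cluster. -/
def clusterWeight {k n : ℕ} (ω : Fin n → ℝ) (ξ : Fin k → Fin n → ℝ) (i : Fin k) : ℝ :=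
  ∑ j, ξ i j * ω j

/-- `ξ` is a weight-constrained `k`-clustering (an element of `C_K(k,X,Ω)`). -/
def IsWCC {k n : ℕ} (κlo κhi : Fin k → ℝ) (ω : Fin n → ℝ) (ξ : Fin k → Fin n → ℝ) : Prop :=
  IsClustering ξ ∧ ∀ i, κlo i ≤ clusterWeight ω ξ i ∧ clusterWeight ω ξ i ≤ κhi i

/-- `cost_{A,K}(X,C,S)`. -/
def cost {d k n : ℕ} (A : Fin k → Matrix (Fin d) (Fin d) ℝ)
    (x : Fin n → Fin d → ℝ) (ω : Fin n → ℝ) (ξ : Fin k → Fin n → ℝ)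
    (s : Fin k → Fin d → ℝ) : ℝ :=
  ∑ i, ∑ j, ξ i j * ω j * anormSq (A i) (x j - s i)

/-- `cost_{A,K}(X,S)`: optimal constrained assignment cost for fixed sites `s`. -/
def assignCost {d k n : ℕ} (κlo κhi : Fin k → ℝ) (A : Fin k → Matrix (Fin d) (Fin d) ℝ)
    (x : Fin n → Fin d → ℝ) (ω : Fin n → ℝ) (s : Fin k → Fin d → ℝ) : ℝ :=
  sInf {c : ℝ | ∃ ξ, IsWCC κlo κhi ω ξ ∧ c = cost A x ω ξ s}

/-- `cost_{A,K}(X,C)`: infimum over site tuples. -/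
def clusterCost {d k n : ℕ} (A : Fin k → Matrix (Fin d) (Fin d) ℝ)
    (x : Fin n → Fin d → ℝ) (ω : Fin n → ℝ) (ξ : Fin k → Fin n → ℝ) : ℝ :=
  sInf {c : ℝ | ∃ s : Fin k → Fin d → ℝ, c = cost A x ω ξ s}

/-- `OPT_{A,K}(X)`. -/
def OPTc {d k n : ℕ} (κlo κhi : Fin k → ℝ) (A : Fin k → Matrix (Fin d) (Fin d) ℝ)
    (x : Fin n → Fin d → ℝ) (ω : Fin n → ℝ) : ℝ :=
  sInf {c : ℝ | ∃ ξ, IsWCC κlo κhi ω ξ ∧ c = clusterCost A x ω ξ}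

/-- Unconstrained optimum `OPT_A(X)` (over all clusterings and all site tuples). -/
def OPTu {d k n : ℕ} (A : Fin k → Matrix (Fin d) (Fin d) ℝ)
    (x : Fin n → Fin d → ℝ) (ω : Fin n → ℝ) : ℝ :=
  sInf {c : ℝ | ∃ ξ, ∃ s : Fin k → Fin d → ℝ, IsClustering ξ ∧ c = cost A x ω ξ s}

/-- `(X',Ω')` is an `(ε,δ)`-coreset for `(k,X,Ω,A,K)`, witnessed by the extension `f`
and the offsets `Δp`, `Δm`. -/
def IsCoresetWith {d k n m : ℕ} (ε δ : ℝ) (κlo κhi : Fin k → ℝ)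
    (A : Fin k → Matrix (Fin d) (Fin d) ℝ)
    (x : Fin n → Fin d → ℝ) (ω : Fin n → ℝ)
    (x' : Fin m → Fin d → ℝ) (ω' : Fin m → ℝ)
    (f : (Fin k → Fin m → ℝ) → (Fin k → Fin n → ℝ)) (Δp Δm : ℝ) : Prop :=
  0 ≤ Δp ∧ Δp ≤ δ * Δm ∧
  (∀ ξ', IsWCC κlo κhi ω' ξ' → IsWCC κlo κhi ω (f ξ')) ∧
  ∀ (s : Fin k → Fin d → ℝ) (ξ' : Fin k → Fin m → ℝ), IsWCC κlo κhi ω' ξ' →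
    (1 - ε) * cost A x ω (f ξ') s ≤ cost A x' ω' ξ' s + Δp ∧
    assignCost κlo κhi A x' ω' s + Δm ≤ (1 + ε) * assignCost κlo κhi A x ω s


lemma anormSq_add {d : ℕ} (A : Matrix (Fin d) (Fin d) ℝ) (u w : Fin d → ℝ) :
    anormSq A (u + w) = anormSq A u + u ⬝ᵥ A.mulVec w + w ⬝ᵥ A.mulVec u + anormSq A w := by
  simp only [anormSq, Matrix.mulVec_add, dotProduct_add, add_dotProduct]
  ring

/-- Parallel axis identity: the weighted squared distances to `z` split into the part of the
weighted centroid `c` and the variation around `c`. -/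
lemma sum_mul_anormSq_sub {ι : Type*} {d : ℕ} (A : Matrix (Fin d) (Fin d) ℝ) (B : Finset ι)
    (ω : ι → ℝ) (x : ι → Fin d → ℝ) (c z : Fin d → ℝ)
    (hc : ∑ j ∈ B, ω j • (x j - c) = 0) :
    ∑ j ∈ B, ω j * anormSq A (x j - z) =
      (∑ j ∈ B, ω j) * anormSq A (c - z) + ∑ j ∈ B, ω j * anormSq A (x j - c) := by
  have hleft : ∑ j ∈ B, ω j * ((x j - c) ⬝ᵥ A.mulVec (c - z)) = 0 := by
    have h := congrArg (· ⬝ᵥ A.mulVec (c - z)) hc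
    simpa only [sum_dotProduct, smul_dotProduct, smul_eq_mul, zero_dotProduct] using h
  have hright : ∑ j ∈ B, ω j * ((c - z) ⬝ᵥ A.mulVec (x j - c)) = 0 := by
    have h := congrArg (fun v => (c - z) ⬝ᵥ A.mulVec v) hc
    simpa only [Matrix.mulVec_sum, dotProduct_sum, Matrix.mulVec_smul, dotProduct_smul,
      smul_eq_mul, Matrix.mulVec_zero, dotProduct_zero] using h
  have hterm : ∀ j, ω j * anormSq A (x j - z) =
      ω j * anormSq A (c - z) + ω j * anormSq A (x j - c)
        + ω j * ((x j - c) ⬝ᵥ A.mulVec (c - z)) + ω j * ((c - z) ⬝ᵥ A.mulVec (x j - c)) := by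
    intro j
    rw [← sub_add_sub_cancel (x j) c z, anormSq_add]
    ring
  simp only [hterm, sum_add_distrib, hleft, hright, sum_mul, add_zero]

/-- A cluster with full membership of a point excludes every other cluster. -/
lemma IsClustering.eq_ite_of_eq_one {k n : ℕ} {ξ : Fin k → Fin n → ℝ} (hξ : IsClustering ξ)
    {i₀ : Fin k} {j : Fin n} (h : ξ i₀ j = 1) (i : Fin k) :
    ξ i j = if i = i₀ then 1 else 0 := by
  split_ifs with hi
  · rw [hi, h]
  · have hle : ∑ l ∈ {i, i₀}, ξ l j ≤ ∑ l, ξ l j :=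
      sum_le_sum_of_subset_of_nonneg (subset_univ _) fun l _ _ => hξ.1 l j
    rw [sum_pair hi, hξ.2 j, h] at hle
    linarith [hξ.1 i j]

theorem statement19 {d k n m : ℕ}
    (A : Fin k → Matrix (Fin d) (Fin d) ℝ) (hA : ∀ i, (A i).PosDef)
    (κlo κhi : Fin k → ℝ)
    (xb : Fin n → Fin d → ℝ) (ω : Fin n → ℝ) (hω : ∀ j, 0 < ω j)
    (p : Fin n → Fin m) (hp : Function.Surjective p)
    (ωB : Fin m → ℝ) (hωB : ωB = fun j' => ∑ j ∈ univ.filter (fun j => p j = j'), ω j)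
    (xB : Fin m → Fin d → ℝ)
    (hxB : xB = fun j' => (ωB j')⁻¹ • ∑ j ∈ univ.filter (fun j => p j = j'), ω j • xb j)
    (lm : ℝ) (hlow : ∀ i (u : Fin d → ℝ), lm * (u ⬝ᵥ u) ≤ anormSq (A i) u)
    (ξb : Fin k → Fin n → ℝ) (hξb : IsWCC κlo κhi ω ξb)
    (hfull : ∀ j' : Fin m, ∃ i : Fin k, ∀ j, p j = j' → ξb i j = 1)
    (ξB : Fin k → Fin m → ℝ)
    (hξB : ξB = fun i j' => (ωB j')⁻¹ * ∑ j ∈ univ.filter (fun j => p j = j'), ξb i j * ω j)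
    (s : Fin k → Fin d → ℝ)
    (V : Fin m → ℝ)
    (hV : V = fun j' => ∑ j ∈ univ.filter (fun j => p j = j'),
      ω j * ((xb j - xB j') ⬝ᵥ (xb j - xB j'))) :
    cost A xB ωB ξB s + lm * ∑ j', V j' ≤ cost A xb ω ξb s := by
  obtain ⟨hC, -⟩ := hξb
  choose ι hι using hfull
  have hb : ∀ i j, ξb i j = if i = ι (p j) then 1 else 0 := fun i j =>
    hC.eq_ite_of_eq_one (hι (p j) j rfl) i
  have hpos : ∀ j', 0 < ωB j' := by
    intro j'
    obtain ⟨j, hj⟩ := hp j'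
    rw [hωB]
    exact sum_pos (fun j _ => hω j) ⟨j, by simpa using hj⟩
  have hB : ∀ i j', ξB i j' = if i = ι j' then 1 else 0 := by
    intro i j'
    have hsum : ∑ j ∈ univ.filter (fun j => p j = j'), ξb i j * ω j =
        (if i = ι j' then 1 else 0) * ωB j' := by
      rw [hωB, mul_sum]
      refine sum_congr rfl fun j hj => ?_
      rw [hb, (mem_filter.1 hj).2]
    simp only [hξB, hsum]
    field_simp [(hpos j').ne']
  have hcentroid : ∀ j', ∑ j ∈ univ.filter (fun j => p j = j'), ω j • (xb j - xB j') = 0 := by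
    intro j'
    have hsmul : ∑ j ∈ univ.filter (fun j => p j = j'), ω j • xb j = ωB j' • xB j' := by
      simp only [hxB, smul_smul, mul_inv_cancel₀ (hpos j').ne', one_smul]
    simp only [smul_sub, sum_sub_distrib, ← sum_smul]
    rw [hsmul, hωB, sub_self]
  have hbatch : ∀ j', ωB j' * anormSq (A (ι j')) (xB j' - s (ι j')) + lm * V j' ≤
      ∑ j ∈ univ.filter (fun j => p j = j'), ω j * anormSq (A (ι j')) (xb j - s (ι j')) := by
    intro j'
    rw [sum_mul_anormSq_sub _ _ _ _ _ _ (hcentroid j'), hV, hωB, mul_sum]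
    refine add_le_add le_rfl (sum_le_sum fun j _ => ?_)
    rw [mul_left_comm]
    exact mul_le_mul_of_nonneg_left (hlow _ _) (hω j).le
  have hcostB : cost A xB ωB ξB s =
      ∑ j', ωB j' * anormSq (A (ι j')) (xB j' - s (ι j')) := by
    rw [cost, sum_comm]
    simp [hB]
  have hcost : cost A xb ω ξb s = ∑ j', ∑ j ∈ univ.filter (fun j => p j = j'),
      ω j * anormSq (A (ι j')) (xb j - s (ι j')) := by
    rw [cost, sum_comm, ← sum_fiberwise _ p]
    refine sum_congr rfl fun j' _ => sum_congr rfl fun j hj => ?_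
    simp [hb, (mem_filter.1 hj).2]
  rw [hcostB, hcost, mul_sum, ← sum_add_distrib]
  exact sum_le_sum fun j' _ => hbatch j'

end
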